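/- Let c : ℝ → ℝ² be a smooth 2π-periodic immersion and h : ℝ → ℝ² a smooth 2π-periodic map. For each θ, the function t ↦ ⟨J(c+th)'(θ), (c+th)''(θ)⟩/|(c+th)'(θ)|³ (the curvature of c + t h at θ, defined for small |t|) is differentiable at t = 0, with derivative ⟨D_s² h (θ), n(θ)⟩ − 2 κ_c(θ) ⟨D_s h (θ), v(θ)⟩. -/

import Mathlib

open Real MeasureTheory

/-- Euclidean inner product on ℝ² ≅ ℂ. -/
noncomputable def dot (x y : ℂ) : ℝ := x.re * y.re + x.im * y.im

/-- Curvature κ_c = ⟨Jc', c''⟩ / |c'|³, with J = rotation by 90° (mult. by `Complex.I`). -/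
noncomputable def curvature (c : ℝ → ℂ) (θ : ℝ) : ℝ :=
  dot (Complex.I * deriv c θ) (deriv (deriv c) θ) / ‖deriv c θ‖ ^ 3

/-- Unit tangent v = c'/|c'|. -/
noncomputable def unitTangent (c : ℝ → ℂ) (θ : ℝ) : ℂ := ‖deriv c θ‖⁻¹ • deriv c θ

/-- Unit normal n = J v. -/
noncomputable def unitNormal (c : ℝ → ℂ) (θ : ℝ) : ℂ := Complex.I * unitTangent c θ

/-- Arclength derivative D_s f = f'/|c'| (for ℂ-valued f), to be iterated for D_s². -/
noncomputable def Ds (c : ℝ → ℂ) (f : ℝ → ℂ) : ℝ → ℂ := fun θ => ‖deriv c θ‖⁻¹ • deriv f θ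

lemma hasDerivAt_dot {f g : ℝ → ℂ} {f' g' : ℂ} {x : ℝ} (hf : HasDerivAt f f' x)
    (hg : HasDerivAt g g' x) :
    HasDerivAt (fun t => dot (f t) (g t)) (dot f' (g x) + dot (f x) g') x := by
  have r : ∀ {k : ℝ → ℂ} {k' : ℂ}, HasDerivAt k k' x →
      HasDerivAt (fun t => (k t).re) k'.re x := fun hk =>
    Complex.reCLM.hasFDerivAt.comp_hasDerivAt x hk
  have i : ∀ {k : ℝ → ℂ} {k' : ℂ}, HasDerivAt k k' x →
      HasDerivAt (fun t => (k t).im) k'.im x := fun hk =>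
    Complex.imCLM.hasFDerivAt.comp_hasDerivAt x hk
  unfold dot
  refine (((r hf).mul (r hg)).add ((i hf).mul (i hg))).congr_deriv ?_
  ring

lemma norm_eq_sqrt_dot (z : ℂ) : ‖z‖ = √(dot z z) := by
  rw [Complex.norm_def, Complex.normSq_apply]; rfl

lemma sq_norm_eq_dot (z : ℂ) : ‖z‖ ^ 2 = dot z z := by
  rw [← Complex.normSq_eq_norm_sq, Complex.normSq_apply]; rfl

lemma hasDerivAt_norm_dot {f : ℝ → ℂ} {f' : ℂ} {x : ℝ} (hf : HasDerivAt f f' x)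
    (h0 : f x ≠ 0) :
    HasDerivAt (fun t => ‖f t‖) (dot (f x) f' / ‖f x‖) x := by
  have hn : ‖f x‖ ≠ 0 := norm_ne_zero_iff.2 h0
  have h1 := (hasDerivAt_dot hf hf).sqrt (by rw [← sq_norm_eq_dot]; positivity)
  simp only [← norm_eq_sqrt_dot] at h1
  refine h1.congr_deriv ?_
  unfold dot
  field_simp
  ring

/-- the curvature of c + t h at θ is differentiable in t at t = 0, with
derivative ⟨D_s²h, n⟩ − 2 κ_c ⟨D_s h, v⟩. -/
theorem stmt1 (c h : ℝ → ℂ)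
    (hc : ContDiff ℝ (⊤ : ℕ∞) c) (hcper : ∀ θ, c (θ + 2 * π) = c θ)
    (hcimm : ∀ θ, deriv c θ ≠ 0)
    (hh : ContDiff ℝ (⊤ : ℕ∞) h) (hhper : ∀ θ, h (θ + 2 * π) = h θ) (θ : ℝ) :
    HasDerivAt (fun t : ℝ => curvature (fun x => c x + t • h x) θ)
      (dot ((Ds c)^[2] h θ) (unitNormal c θ)
        - 2 * curvature c θ * dot (Ds c h θ) (unitTangent c θ)) 0 := by
  have hc1 : ContDiff ℝ (⊤ : ℕ∞) (deriv c) := ((contDiff_infty_iff_deriv (𝕜 := ℝ)).1 hc).2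
  have hh1 : ContDiff ℝ (⊤ : ℕ∞) (deriv h) := ((contDiff_infty_iff_deriv (𝕜 := ℝ)).1 hh).2
  have dc : Differentiable ℝ c := ((contDiff_infty_iff_deriv (𝕜 := ℝ)).1 hc).1
  have dh : Differentiable ℝ h := ((contDiff_infty_iff_deriv (𝕜 := ℝ)).1 hh).1
  have dc1 : Differentiable ℝ (deriv c) := ((contDiff_infty_iff_deriv (𝕜 := ℝ)).1 hc1).1
  have dh1 : Differentiable ℝ (deriv h) := ((contDiff_infty_iff_deriv (𝕜 := ℝ)).1 hh1).1
  have e1 : ∀ t : ℝ, deriv (fun x => c x + t • h x) = fun x => deriv c x + t • deriv h x :=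
    fun t => funext fun x => ((dc x).hasDerivAt.add ((dh x).hasDerivAt.const_smul t)).deriv
  have e2 : ∀ t : ℝ, deriv (fun x => deriv c x + t • deriv h x) θ
      = deriv (deriv c) θ + t • deriv (deriv h) θ :=
    fun t => ((dc1 θ).hasDerivAt.add ((dh1 θ).hasDerivAt.const_smul t)).deriv
  have hN := hasDerivAt_norm_dot (dc1 θ).hasDerivAt (hcimm θ)
  have hn : ‖deriv c θ‖ ≠ 0 := norm_ne_zero_iff.2 (hcimm θ)
  have hD : deriv (Ds c h) θ = _ := ((hN.inv hn).smul (dh1 θ).hasDerivAt).deriv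
  have hD2 : (Ds c)^[2] h θ = ‖deriv c θ‖⁻¹ • deriv (Ds c h) θ := rfl
  rw [hD2, hD]
  simp only [curvature, e1, e2, unitNormal, unitTangent, Ds, Pi.inv_apply]
  have hsq := sq_norm_eq_dot (deriv c θ)
  generalize deriv (deriv c) θ = b at *
  generalize deriv (deriv h) θ = q at *
  generalize deriv h θ = p at *
  have ha := hcimm θ
  clear hD hD2 hN e1 e2 hcimm
  generalize deriv c θ = a at *
  have lin : ∀ u w : ℂ, HasDerivAt (fun t : ℝ => u + t • w) w 0 := fun u w => by
    simpa using ((hasDerivAt_id (0 : ℝ)).smul_const w).const_add u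
  have K1 := hasDerivAt_dot ((lin a p).const_mul Complex.I) (lin b q)
  have K2 := (hasDerivAt_norm_dot (lin a p) (by simpa using ha)).pow 3
  have K := K1.div K2 (by simpa using hn)
  refine HasDerivAt.congr_deriv K (Eq.symm ?_)
  simp only [zero_smul, add_zero, Pi.pow_apply]
  generalize ‖a‖ = r at *
  obtain ⟨a1, a2⟩ := a
  obtain ⟨b1, b2⟩ := b
  obtain ⟨p1, p2⟩ := p
  obtain ⟨q1, q2⟩ := q
  clear K K1 K2 lin
  simp only [dot] at hsq ⊢
  simp only [Complex.smul_re, Complex.smul_im, Complex.add_re, Complex.add_im, Complex.mul_re,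
    Complex.mul_im, Complex.I_re, Complex.I_im, smul_eq_mul, zero_mul, one_mul, zero_sub, zero_add, Nat.cast_ofNat]
  field_simp
  linear_combination r ^ 2 * (p2 * b1 - p1 * b2) * hsq
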